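/- arXiv:2009.00181 — 2 statements merged into one kernel-verified Lean document; each statement's English description precedes it below -/
import Mathlib

section
/- For any integers s ≥ 2 and n ≥ 2k+1, the maximum number of copies of K_s in a graph on n vertices containing no matching with k+1 edges equals max{C(2k+1, s), C(k, s) + (n−k)·C(k, s−1)}. -/
open SimpleGraph Finset

/-- `G` contains a linear forest with `k` edges: a subgraph that is acyclic
with maximum degree at most 2 and exactly `k` edges. -/
def containsLinearForest {V : Type*} (G : SimpleGraph V) (k : ℕ) : Prop :=
  ∃ H : SimpleGraph V, H ≤ G ∧ H.IsAcyclic ∧ (∀ v, (H.neighborSet v).ncard ≤ 2) ∧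
    H.edgeSet.ncard = k

/-- `G` contains a matching with `k` edges. -/
def containsMatching {V : Type*} (G : SimpleGraph V) (k : ℕ) : Prop :=
  ∃ H : SimpleGraph V, H ≤ G ∧ (∀ v, (H.neighborSet v).ncard ≤ 1) ∧ H.edgeSet.ncard = k

/-- Number of `s`-cliques (copies of `K_s`) in `G`. -/
noncomputable def cliqueCount {V : Type*} (G : SimpleGraph V) (s : ℕ) : ℕ :=
  {S : Finset V | G.IsNClique s S}.ncard

/-- Number of copies of `K*_{s,t}` in `G`: pairs `(W₁, W₂)` of disjoint vertex sets with
`|W₁| = s`, `|W₂| = t`, `W₁` a clique and all `W₁`–`W₂` edges present. -/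
noncomputable def kstCount {V : Type*} (G : SimpleGraph V) (s t : ℕ) : ℕ :=
  {p : Finset V × Finset V | p.1.card = s ∧ p.2.card = t ∧ Disjoint p.1 p.2 ∧
    G.IsClique (p.1 : Set V) ∧ ∀ a ∈ p.1, ∀ b ∈ p.2, G.Adj a b}.ncard

/-- The `(i, j)`-shift of `G`: every edge `xj` with `x ≠ i` and `xi` not an edge becomes `xi`. -/
def shiftGraph {V : Type*} [DecidableEq V] (G : SimpleGraph V) (i j : V) : SimpleGraph V :=
  SimpleGraph.fromRel fun a b =>
    (a ≠ i ∧ a ≠ j ∧ b ≠ i ∧ b ≠ j ∧ G.Adj a b) ∨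
    (a = i ∧ b = j ∧ G.Adj a b) ∨
    (a = i ∧ b ≠ j ∧ (G.Adj i b ∨ G.Adj j b)) ∨
    (a = j ∧ b ≠ i ∧ G.Adj i b ∧ G.Adj j b)

section Shift

variable {V : Type*} [DecidableEq V] {G : SimpleGraph V} {i j : V}

lemma shiftGraph_adj_of_ne {a b : V} (hai : a ≠ i) (haj : a ≠ j) (hbi : b ≠ i) (hbj : b ≠ j) :
    (shiftGraph G i j).Adj a b ↔ G.Adj a b := by
  have := G.ne_of_adj (a := a) (b := b)
  have := G.adj_comm a b
  simp only [shiftGraph, SimpleGraph.fromRel_adj]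
  grind

lemma shiftGraph_adj_fst_snd (hij : i ≠ j) : (shiftGraph G i j).Adj i j ↔ G.Adj i j := by
  have := G.adj_comm i j
  simp only [shiftGraph, SimpleGraph.fromRel_adj]
  grind

lemma shiftGraph_adj_fst {b : V} (hij : i ≠ j) (hbi : b ≠ i) (hbj : b ≠ j) :
    (shiftGraph G i j).Adj i b ↔ G.Adj i b ∨ G.Adj j b := by
  simp only [shiftGraph, SimpleGraph.fromRel_adj]
  grind

lemma shiftGraph_adj_snd {b : V} (hij : i ≠ j) (hbi : b ≠ i) (hbj : b ≠ j) :
    (shiftGraph G i j).Adj j b ↔ G.Adj i b ∧ G.Adj j b := by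
  simp only [shiftGraph, SimpleGraph.fromRel_adj]
  grind

lemma containsMatching_of_containsMatching_shiftGraph [Finite V] (hij : i ≠ j) {m : ℕ}
    (h : containsMatching (shiftGraph G i j) m) : containsMatching G m := by
  obtain ⟨H, hle, hdeg, hcard⟩ := h
  by_cases hG : H ≤ G
  · exact ⟨H, hG, hdeg, hcard⟩
  have huniq : ∀ v a b, H.Adj v a → H.Adj v b → a = b := fun v a b ha hb =>
    (Set.ncard_le_one (Set.toFinite _)).1 (hdeg v) a ha b hb
  obtain ⟨x, hxi, hxj, hHx, hGx⟩ : ∃ x, x ≠ i ∧ x ≠ j ∧ H.Adj i x ∧ G.Adj j x := by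
    have hG' : ∃ a b, H.Adj a b ∧ ¬ G.Adj a b := by
      by_contra! hc
      exact hG hc
    obtain ⟨a, b, hab, hnab⟩ := hG'
    have hS := hle hab
    have := hab.symm
    have := G.adj_comm a b
    simp only [shiftGraph, SimpleGraph.fromRel_adj] at hS
    grind
  have hfst : ∀ d, H.Adj i d → d = x := fun d hd => huniq i d x hd hHx
  have hsnd : ∀ d, H.Adj j d → d ≠ i ∧ d ≠ j ∧ G.Adj i d := by
    intro d hd
    have hdi : d ≠ i := by
      rintro rfl
      exact hxj (huniq d j x hd.symm hHx).symm
    exact ⟨hdi, hd.ne', ((shiftGraph_adj_snd hij hdi hd.ne').1 (hle hd)).1⟩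
  refine ⟨H.map (Equiv.swap i j).toEmbedding, ?_, fun v => ?_, ?_⟩
  · rw [SimpleGraph.map_le_iff_le_comap]
    have key : ∀ c d, (c = i ∨ c = j) → H.Adj c d →
        G.Adj (Equiv.swap i j c) (Equiv.swap i j d) := by
      rintro c d (rfl | rfl) hcd
      · obtain rfl := hfst d hcd
        rwa [Equiv.swap_apply_left, Equiv.swap_apply_of_ne_of_ne hxi hxj]
      · obtain ⟨hdi, hdj, hd⟩ := hsnd d hcd
        rwa [Equiv.swap_apply_right, Equiv.swap_apply_of_ne_of_ne hdi hdj]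
    intro c d hcd
    simp only [SimpleGraph.comap_adj, Equiv.coe_toEmbedding]
    by_cases hc : c = i ∨ c = j
    · exact key c d hc hcd
    by_cases hd : d = i ∨ d = j
    · exact (key d c hd hcd.symm).symm
    push Not at hc hd
    rw [Equiv.swap_apply_of_ne_of_ne hc.1 hc.2, Equiv.swap_apply_of_ne_of_ne hd.1 hd.2]
    exact (shiftGraph_adj_of_ne hc.1 hc.2 hd.1 hd.2).1 (hle hcd)
  · refine le_trans ?_ (hdeg (Equiv.swap i j v))
    refine Set.ncard_le_ncard_of_injOn (Equiv.swap i j) ?_ (Equiv.injective _).injOn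
      (Set.toFinite _)
    rintro w ⟨-, a, b, hab, rfl, rfl⟩
    simpa using hab
  · rw [SimpleGraph.edgeSet_map, Set.ncard_image_of_injective _ (Function.Embedding.injective _),
      hcard]

/-- The effect of the `(i, j)`-shift on cliques. -/
noncomputable def shiftClique (G : SimpleGraph V) (i j : V) (K : Finset V) : Finset V :=
  open Classical in if (shiftGraph G i j).IsClique (K : Set V) then K else insert i (K.erase j)

lemma mem_of_not_isClique_shiftGraph (hij : i ≠ j) {K : Finset V}
    (hK : G.IsClique (K : Set V)) (h : ¬ (shiftGraph G i j).IsClique (K : Set V)) :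
    j ∈ K ∧ i ∉ K := by
  simp only [SimpleGraph.isClique_iff, Set.Pairwise, Finset.mem_coe] at hK h
  by_contra hc
  apply h
  intro a ha b hb hab
  have h1 := hK ha hb hab
  have e1 := G.adj_comm
  have e2 := (shiftGraph G i j).adj_comm
  have := shiftGraph_adj_of_ne (G := G) (i := i) (j := j) (a := a) (b := b)
  have := shiftGraph_adj_fst_snd (G := G) hij
  have := fun b => shiftGraph_adj_fst (G := G) (b := b) hij
  have := fun b => shiftGraph_adj_snd (G := G) (b := b) hij
  by_cases a = i <;> by_cases a = j <;> by_cases b = i <;> by_cases b = j <;> grind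

lemma isNClique_shiftClique (hij : i ≠ j) {s : ℕ} {K : Finset V} (hK : G.IsNClique s K) :
    (shiftGraph G i j).IsNClique s (shiftClique G i j K) := by
  rw [shiftClique]
  split_ifs with h
  · exact ⟨h, hK.2⟩
  obtain ⟨hj, hi⟩ := mem_of_not_isClique_shiftGraph hij hK.1 h
  have hK1 := hK.1
  refine ⟨?_, ?_⟩
  · simp only [SimpleGraph.isClique_iff, Set.Pairwise, Finset.mem_coe] at hK1 ⊢
    intro a ha b hb hab
    have e1 := G.adj_comm
    have e2 := (shiftGraph G i j).adj_comm
    have := shiftGraph_adj_of_ne (G := G) (i := i) (j := j) (a := a) (b := b)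
    have := fun b => shiftGraph_adj_fst (G := G) (b := b) hij
    by_cases a = i <;> by_cases a = j <;> by_cases b = i <;> by_cases b = j <;> grind
  · rw [Finset.card_insert_of_notMem (by simp [hi]), Finset.card_erase_add_one hj, hK.2]

lemma shiftClique_injOn (hij : i ≠ j) :
    Set.InjOn (shiftClique G i j) {K | G.IsClique (K : Set V)} := by
  have key : ∀ K L : Finset V, G.IsClique (K : Set V) → G.IsClique (L : Set V) →
      ¬ (shiftGraph G i j).IsClique (K : Set V) → L ≠ insert i (K.erase j) := by
    rintro K L hK hL h rfl
    obtain ⟨hj, hi⟩ := mem_of_not_isClique_shiftGraph hij hK h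
    apply h
    simp only [SimpleGraph.isClique_iff, Set.Pairwise, Finset.mem_coe] at hK hL ⊢
    intro a ha b hb hab
    have e1 := G.adj_comm
    have e2 := (shiftGraph G i j).adj_comm
    have := shiftGraph_adj_of_ne (G := G) (i := i) (j := j) (a := a) (b := b)
    have := fun b => shiftGraph_adj_snd (G := G) (b := b) hij
    by_cases a = i <;> by_cases a = j <;> by_cases b = i <;> by_cases b = j <;> grind
  intro K hK L hL h
  simp only [shiftClique] at h
  split_ifs at h with h1 h2 h2
  · exact h
  · exact absurd h (key L K hL hK h2)
  · exact absurd h.symm (key K L hK hL h1)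
  · obtain ⟨hj, hi⟩ := mem_of_not_isClique_shiftGraph hij hK h1
    obtain ⟨hj', hi'⟩ := mem_of_not_isClique_shiftGraph hij hL h2
    ext x
    have := Finset.ext_iff.1 h x
    grind

end Shift

lemma cliqueCount_eq_card {V : Type*} [Fintype V] (G : SimpleGraph V) (s : ℕ)
    [DecidablePred fun K : Finset V => G.IsNClique s K] :
    cliqueCount G s = #{K : Finset V | G.IsNClique s K} := by
  rw [cliqueCount, ← Set.ncard_coe_finset]
  simp

lemma cliqueCount_le_cliqueCount_shiftGraph {V : Type*} [Fintype V] [DecidableEq V]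
    (G : SimpleGraph V) {i j : V} (hij : i ≠ j) (s : ℕ) :
    cliqueCount G s ≤ cliqueCount (shiftGraph G i j) s := by
  classical
  rw [cliqueCount_eq_card, cliqueCount_eq_card]
  refine Finset.card_le_card_of_injOn (shiftClique G i j) ?_ ?_
  · intro K hK
    simpa using isNClique_shiftClique hij (by simpa using hK)
  · intro K hK L hL h
    simp only [Finset.coe_filter, Finset.mem_univ, true_and, Set.mem_ofPred_eq] at hK hL
    exact shiftClique_injOn hij hK.1 hL.1 h

open Classical in
/-- A potential that increases under shifts towards smaller vertices. -/
noncomputable def edgeWeight {n : ℕ} (G : SimpleGraph (Fin n)) : ℕ :=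
  ∑ K : Finset (Fin n) with G.IsNClique 2 K, ∑ v ∈ K, (n - v : ℕ)

lemma edgeWeight_lt_edgeWeight_shiftGraph {n : ℕ} {G : SimpleGraph (Fin n)} {i j x : Fin n}
    (hij : i < j) (hxi : x ≠ i) (hxj : G.Adj x j) (hx : ¬ G.Adj x i) :
    edgeWeight G < edgeWeight (shiftGraph G i j) := by
  classical
  have hmaps : ∀ K ∈ ({K | G.IsNClique 2 K} : Finset (Finset (Fin n))),
      shiftClique G i j K ∈
        ({K | (shiftGraph G i j).IsNClique 2 K} : Finset (Finset (Fin n))) := by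
    intro K hK
    simpa using isNClique_shiftClique hij.ne (by simpa using hK)
  have hinj : Set.InjOn (shiftClique G i j)
      ({K | G.IsNClique 2 K} : Finset (Finset (Fin n))) := by
    intro K hK L hL h
    simp only [Finset.coe_filter, Finset.mem_univ, true_and, Set.mem_ofPred_eq] at hK hL
    exact shiftClique_injOn hij.ne hK.1 hL.1 h
  have hlt : ∀ K : Finset (Fin n), j ∈ K → i ∉ K →
      ∑ v ∈ K, (n - v : ℕ) < ∑ v ∈ insert i (K.erase j), (n - v : ℕ) := by
    intro K hj hi
    rw [Finset.sum_insert (by simp [hi]), ← Finset.add_sum_erase _ _ hj]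
    have : (i : ℕ) < j := hij
    omega
  rw [edgeWeight, edgeWeight]
  calc _ < ∑ K : Finset (Fin n) with G.IsNClique 2 K, ∑ v ∈ shiftClique G i j K, (n - v : ℕ) := by
        refine Finset.sum_lt_sum ?_ ⟨{x, j}, ?_, ?_⟩
        · intro K hK
          rw [shiftClique]
          split_ifs with h
          · exact le_rfl
          obtain ⟨hj, hi⟩ := mem_of_not_isClique_shiftGraph hij.ne (by simp at hK; exact hK.1) h
          exact (hlt K hj hi).le
        · simp [SimpleGraph.isNClique_iff, hxj, hxj.ne]
        · rw [shiftClique, if_neg]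
          · exact hlt _ (by simp) (by simp [hij.ne, hxi.symm])
          · intro h
            have h1 := h (by simp : x ∈ _) (by simp : j ∈ _) hxj.ne
            rw [SimpleGraph.adj_comm, shiftGraph_adj_snd hij.ne hxi hxj.ne] at h1
            exact hx h1.1.symm
    _ = ∑ K ∈ (({K | G.IsNClique 2 K} : Finset (Finset (Fin n))).image (shiftClique G i j)),
          ∑ v ∈ K, (n - v : ℕ) := by
        rw [Finset.sum_image hinj]
    _ ≤ _ := Finset.sum_le_sum_of_subset (Finset.image_subset_iff.2 hmaps)

/-- Every graph can be replaced by a shifted one without creating larger matchings or losing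
`s`-cliques. -/
lemma exists_shifted {n m : ℕ} (G : SimpleGraph (Fin n)) (hG : ¬ containsMatching G m) (s : ℕ) :
    ∃ G' : SimpleGraph (Fin n), ¬ containsMatching G' m ∧ cliqueCount G s ≤ cliqueCount G' s ∧
      ∀ i j x : Fin n, i ≤ j → x ≠ i → G'.Adj x j → G'.Adj x i := by
  classical
  obtain ⟨G', hG', hmax⟩ := Set.exists_max_image
    {G' : SimpleGraph (Fin n) | ¬ containsMatching G' m ∧ cliqueCount G s ≤ cliqueCount G' s}
    edgeWeight (Set.toFinite _) ⟨G, hG, le_rfl⟩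
  refine ⟨G', hG'.1, hG'.2, fun i j x hij hxi hxj => ?_⟩
  by_contra hx
  have hij : i < j := lt_of_le_of_ne hij (by rintro rfl; exact hx hxj)
  have h1 := hmax (shiftGraph G' i j)
    ⟨fun h => hG'.1 (containsMatching_of_containsMatching_shiftGraph hij.ne h),
      hG'.2.trans (cliqueCount_le_cliqueCount_shiftGraph G' hij.ne s)⟩
  exact absurd (edgeWeight_lt_edgeWeight_shiftGraph hij hxi hxj hx) (not_lt.2 h1)

/-- A discretely convex sequence on `{0, …, k}` attains its maximum at an endpoint. -/
lemma le_max_of_convex {f : ℕ → ℕ} {k : ℕ}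
    (hf : ∀ u, u + 2 ≤ k → 2 * f (u + 1) ≤ f u + f (u + 2)) {u : ℕ} (hu : u ≤ k) :
    f u ≤ max (f 0) (f k) := by
  by_cases h : ∀ v < u, f (v + 1) ≤ f v
  · refine le_max_of_le_left ?_
    have : ∀ v ≤ u, f v ≤ f 0 := by
      intro v
      induction v with
      | zero => simp
      | succ v ih => exact fun hv => (h v hv).trans (ih (by omega))
    exact this u le_rfl
  · push Not at h
    obtain ⟨v, hvu, hv⟩ := h
    refine le_max_of_le_right ?_
    have hinc : ∀ w, v ≤ w → w + 1 ≤ k → f w < f (w + 1) := by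
      intro w hw
      induction w, hw using Nat.le_induction with
      | base => exact fun _ => hv
      | succ w hw ih =>
        intro hk
        have := ih (by omega)
        have : 2 * f (w + 1) ≤ f w + f (w + 1 + 1) := hf w hk
        omega
    have : ∀ w, u ≤ w → w ≤ k → f u ≤ f w := by
      intro w hw
      induction w, hw using Nat.le_induction with
      | base => simp
      | succ w hw ih => exact fun hk => (ih (by omega)).trans (hinc w (by omega) hk).le
    exact this k hu le_rfl

lemma choose_add_mul_choose_le_max {k m t u : ℕ} (hu : u ≤ k) :
    (2 * k + 1 - u).choose (t + 2) + (m + u) * u.choose (t + 1) ≤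
      max ((2 * k + 1).choose (t + 2))
        (k.choose (t + 2) + (m + k + 1) * k.choose (t + 1)) := by
  have h := le_max_of_convex
    (f := fun u => (2 * k + 1 - u).choose (t + 2) + (m + u) * u.choose (t + 1)) (k := k) ?_ hu
  · refine h.trans (max_le_max ?_ ?_)
    · simp
    · have : 2 * k + 1 - k = k + 1 := by omega
      simp only [this, Nat.choose_succ_succ' k (t + 1)]
      exact le_of_eq (by ring)
  · intro u hu
    obtain ⟨a, ha⟩ : ∃ a, 2 * k + 1 - (u + 2) = a := ⟨_, rfl⟩
    have e1 : 2 * k + 1 - (u + 1) = a + 1 := by omega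
    have e2 : 2 * k + 1 - u = a + 2 := by omega
    simp only [ha, e1, e2]
    have c1 := Nat.choose_succ_succ' (a + 1) (t + 1)
    have c2 := Nat.choose_succ_succ' a (t + 1)
    have c3 := Nat.choose_le_choose (t + 1) (Nat.le_succ a)
    have c4 := Nat.choose_succ_succ' u t
    have c5 := Nat.choose_succ_succ' (u + 1) t
    have c6 := Nat.choose_le_choose t (Nat.le_succ u)
    simp only [Nat.succ_eq_add_one, add_assoc, Nat.reduceAdd] at *
    nlinarith

lemma exists_not_adj {n k : ℕ} (hn : 2 * k + 2 ≤ n) {G : SimpleGraph (Fin n)}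
    (hG : ¬ containsMatching G (k + 1)) :
    ∃ a b : Fin n, (a : ℕ) ≤ k ∧ (a + b : ℕ) = 2 * k + 1 ∧ ¬ G.Adj a b := by
  classical
  by_contra! hc
  apply hG
  refine ⟨SimpleGraph.fromRel fun a b : Fin n => (a + b : ℕ) = 2 * k + 1, ?_, ?_, ?_⟩
  · intro a b hab
    rw [SimpleGraph.fromRel_adj] at hab
    rcases le_or_gt (a : ℕ) k with h | h
    · exact hc a b h (by omega)
    · exact (hc b a (by omega) (by omega)).symm
  · intro v
    rw [Set.ncard_le_one]
    intro a ha b hb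
    simp only [SimpleGraph.mem_neighborSet, SimpleGraph.fromRel_adj] at ha hb
    ext
    omega
  · have : (SimpleGraph.fromRel fun a b : Fin n => (a + b : ℕ) = 2 * k + 1).edgeSet =
        (fun i : Fin (k + 1) => s((⟨i, by omega⟩ : Fin n), ⟨2 * k + 1 - i, by omega⟩)) ''
          Set.univ := by
      ext e
      induction e with
      | h a b =>
        simp only [SimpleGraph.mem_edgeSet, SimpleGraph.fromRel_adj, Set.image_univ,
          Set.mem_range, Sym2.eq_iff, Fin.ext_iff, ne_eq]
        constructor
        · intro h
          rcases le_or_gt (a : ℕ) k with h' | h'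
          · exact ⟨⟨a, by omega⟩, by simp; omega⟩
          · exact ⟨⟨b, by omega⟩, by simp; omega⟩
        · rintro ⟨i, hi⟩
          have := i.2
          omega
    rw [this, Set.ncard_image_of_injective]
    · simp
    · intro i j h
      simp only [Sym2.eq_iff, Fin.ext_iff] at h
      have := i.2
      have := j.2
      ext
      omega

lemma card_filter_val_lt_of_le {m n : ℕ} (h : m ≤ n) : #{a : Fin n | (a : ℕ) < m} = m := by
  rw [Fin.card_filter_val_lt, min_eq_right h]

lemma card_filter_le_val {m n : ℕ} (h : m ≤ n) : #{a : Fin n | m ≤ (a : ℕ)} = n - m := by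
  have := Finset.card_filter_add_card_filter_not (s := (Finset.univ : Finset (Fin n)))
    (fun a => (a : ℕ) < m)
  simp only [not_lt, card_filter_val_lt_of_le h, Finset.card_univ, Fintype.card_fin] at this
  omega

lemma cliqueCount_le_of_not_adj {n s u v : ℕ} (huv : u ≤ v) (hvn : v ≤ n)
    {G : SimpleGraph (Fin n)}
    (hG : ∀ a b : Fin n, u ≤ a → v ≤ b → ¬ G.Adj a b) :
    cliqueCount G s ≤ v.choose s + (n - v) * u.choose (s - 1) := by
  classical
  rw [cliqueCount_eq_card]
  have hsub : ∀ K : Finset (Fin n), G.IsNClique s K → K ∈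
      powersetCard s {a : Fin n | (a : ℕ) < v} ∪
        (({a : Fin n | v ≤ (a : ℕ)} : Finset (Fin n)) ×ˢ
          powersetCard (s - 1) {a : Fin n | (a : ℕ) < u}).image fun p => insert p.1 p.2 := by
    intro K hK
    by_cases h : ∃ b ∈ K, v ≤ (b : ℕ)
    · obtain ⟨b, hbK, hb⟩ := h
      refine Finset.mem_union_right _ (Finset.mem_image.2 ⟨(b, K.erase b), ?_, ?_⟩)
      · simp only [Finset.mem_product, Finset.mem_filter, Finset.mem_univ, true_and,
          Finset.mem_powersetCard]
        refine ⟨hb, fun a ha => ?_, by rw [Finset.card_erase_of_mem hbK, hK.2]⟩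
        rw [Finset.mem_erase] at ha
        simp only [Finset.mem_filter, Finset.mem_univ, true_and]
        by_contra hau
        exact hG a b (not_lt.1 hau) hb (hK.1 ha.2 hbK ha.1)
      · exact Finset.insert_erase hbK
    · push Not at h
      refine Finset.mem_union_left _ (Finset.mem_powersetCard.2 ⟨fun a ha => ?_, hK.2⟩)
      simpa using h a ha
  have h2 := Finset.card_union_le (powersetCard s {a : Fin n | (a : ℕ) < v})
    ((({a : Fin n | v ≤ (a : ℕ)} : Finset (Fin n)) ×ˢ
      powersetCard (s - 1) {a : Fin n | (a : ℕ) < u}).image fun p => insert p.1 p.2)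
  have h3 := Finset.card_image_le (f := fun p : Fin n × Finset (Fin n) => insert p.1 p.2)
    (s := ({a : Fin n | v ≤ (a : ℕ)} : Finset (Fin n)) ×ˢ
      powersetCard (s - 1) {a : Fin n | (a : ℕ) < u})
  rw [Finset.card_product, Finset.card_powersetCard, card_filter_le_val hvn,
    card_filter_val_lt_of_le (huv.trans hvn)] at h3
  rw [Finset.card_powersetCard, card_filter_val_lt_of_le hvn] at h2
  exact (Finset.card_le_card fun K hK => hsub K (Finset.mem_filter.1 hK).2).trans
    (h2.trans (Nat.add_le_add_left h3 _))

lemma cliqueCount_le_max {n k s : ℕ} (hs : 2 ≤ s) (hn : 2 * k + 1 ≤ n) {G : SimpleGraph (Fin n)}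
    (hG : ¬ containsMatching G (k + 1)) :
    cliqueCount G s ≤
      max ((2 * k + 1).choose s) (k.choose s + (n - k) * k.choose (s - 1)) := by
  rcases hn.eq_or_lt with rfl | hn
  · refine le_max_of_le_left ?_
    have := cliqueCount_le_of_not_adj (s := s) (u := 0) (v := 2 * k + 1) (by omega)
      le_rfl (G := G) (fun a b _ hb => absurd b.2 (by omega))
    simpa using this
  · obtain ⟨G', hG', hle, hshift⟩ := exists_shifted G hG s
    obtain ⟨a, b, hak, hab, hadj⟩ := exists_not_adj hn hG'
    have hcount := cliqueCount_le_of_not_adj (s := s) (u := a) (v := b) (by omega)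
      b.2.le (G := G') (fun x y hx hy hxy => hadj (by
        have h1 : G'.Adj a y :=
          (hshift a x y hx (by intro h; omega) hxy.symm).symm
        exact hshift b y a hy (by intro h; omega) h1))
    obtain ⟨t, rfl⟩ := Nat.exists_eq_add_of_le' hs
    have h := choose_add_mul_choose_le_max (m := n - (2 * k + 1)) (t := t) hak
    have e1 : 2 * k + 1 - (a : ℕ) = b := by omega
    have e2 : n - (2 * k + 1) + (a : ℕ) = n - b := by omega
    have e3 : n - (2 * k + 1) + k + 1 = n - k := by omega
    rw [e1, e2, e3] at h
    exact (hle.trans hcount).trans h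

lemma degree_le_one_of_ncard_le_one {V : Type*} [Fintype V] {H : SimpleGraph V}
    [DecidableRel H.Adj] {v : V} (h : (H.neighborSet v).ncard ≤ 1) : H.degree v ≤ 1 := by
  rwa [Set.ncard_eq_toFinset_card'] at h

lemma not_containsMatching_of_adj_lt {n k : ℕ} (hn : 2 * k + 1 ≤ n) {G : SimpleGraph (Fin n)}
    (hG : ∀ a b : Fin n, G.Adj a b → (a : ℕ) < 2 * k + 1) : ¬ containsMatching G (k + 1) := by
  classical
  rintro ⟨H, hle, hdeg, hcard⟩
  have hd : ∀ v, H.degree v ≤ if (v : ℕ) < 2 * k + 1 then 1 else 0 := by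
    intro v
    split_ifs with h
    · exact degree_le_one_of_ncard_le_one (hdeg v)
    · rw [Nat.le_zero, ← SimpleGraph.card_neighborFinset_eq_degree, Finset.card_eq_zero,
        Finset.eq_empty_iff_forall_notMem]
      intro w hw
      exact h (hG v w (hle (by simpa using hw)))
  have h1 := H.sum_degrees_eq_twice_card_edges
  have h2 := Finset.sum_le_sum fun v (_ : v ∈ Finset.univ) => hd v
  rw [← Finset.card_filter, card_filter_val_lt_of_le hn, h1] at h2
  rw [Set.ncard_eq_toFinset_card'] at hcard
  change #H.edgeFinset = k + 1 at hcard
  omega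

lemma not_containsMatching_of_adj_lt_or {n k : ℕ} (hkn : k ≤ n) {G : SimpleGraph (Fin n)}
    (hG : ∀ a b : Fin n, G.Adj a b → (a : ℕ) < k ∨ (b : ℕ) < k) :
    ¬ containsMatching G (k + 1) := by
  classical
  rintro ⟨H, hle, hdeg, hcard⟩
  have hsub : H.edgeFinset ⊆
      ({a : Fin n | (a : ℕ) < k} : Finset (Fin n)).biUnion fun a => H.incidenceFinset a := by
    intro e
    induction e with
    | h a b =>
      intro hab
      rw [SimpleGraph.mem_edgeFinset, SimpleGraph.mem_edgeSet] at hab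
      rw [Finset.mem_biUnion]
      rcases hG a b (hle hab) with h | h
      · exact ⟨a, by simpa using h, by simpa [SimpleGraph.mk'_mem_incidenceSet_iff] using hab⟩
      · exact ⟨b, by simpa using h, by simpa [SimpleGraph.mk'_mem_incidenceSet_iff] using hab⟩
  have h1 := (Finset.card_le_card hsub).trans (Finset.card_biUnion_le_card_mul _ _ 1 fun a _ => by
    rw [SimpleGraph.card_incidenceFinset_eq_degree]
    exact degree_le_one_of_ncard_le_one (hdeg a))
  rw [card_filter_val_lt_of_le hkn] at h1
  rw [Set.ncard_eq_toFinset_card'] at hcard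
  change #H.edgeFinset = k + 1 at hcard
  omega

lemma choose_le_cliqueCount {n v s : ℕ} (hvn : v ≤ n) {G : SimpleGraph (Fin n)}
    (hG : ∀ a b : Fin n, (a : ℕ) < v → (b : ℕ) < v → a ≠ b → G.Adj a b) :
    v.choose s ≤ cliqueCount G s := by
  classical
  rw [cliqueCount_eq_card]
  calc v.choose s = #(powersetCard s {a : Fin n | (a : ℕ) < v}) := by
        rw [Finset.card_powersetCard, card_filter_val_lt_of_le hvn]
    _ ≤ _ := Finset.card_le_card fun K hK => by
        rw [Finset.mem_powersetCard] at hK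
        simp only [Finset.mem_filter, Finset.mem_univ, true_and]
        refine ⟨fun a ha b hb hab => hG a b ?_ ?_ hab, hK.2⟩
        · simpa using hK.1 ha
        · simpa using hK.1 hb

lemma choose_add_le_cliqueCount {n k s : ℕ} (hs : 1 ≤ s) (hkn : k ≤ n) {G : SimpleGraph (Fin n)}
    (hG : ∀ a b : Fin n, (a : ℕ) < k → a ≠ b → G.Adj a b) :
    k.choose s + (n - k) * k.choose (s - 1) ≤ cliqueCount G s := by
  classical
  rw [cliqueCount_eq_card]
  set A := powersetCard s ({a : Fin n | (a : ℕ) < k} : Finset (Fin n)) with hA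
  set B := ({a : Fin n | k ≤ (a : ℕ)} : Finset (Fin n)) ×ˢ
    powersetCard (s - 1) ({a : Fin n | (a : ℕ) < k} : Finset (Fin n)) with hB
  have hmemA : ∀ K ∈ A, (∀ a ∈ K, (a : ℕ) < k) ∧ #K = s := by
    intro K hK
    rw [hA, Finset.mem_powersetCard] at hK
    exact ⟨fun a ha => by simpa using hK.1 ha, hK.2⟩
  have hmemB : ∀ p ∈ B, k ≤ (p.1 : ℕ) ∧ (∀ a ∈ p.2, (a : ℕ) < k) ∧ #p.2 = s - 1 := by
    intro p hp
    rw [hB, Finset.mem_product, Finset.mem_powersetCard] at hp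
    exact ⟨by simpa using hp.1, fun a ha => by simpa using hp.2.1 ha, hp.2.2⟩
  have hinj : Set.InjOn (fun p : Fin n × Finset (Fin n) => insert p.1 p.2) B := by
    rintro ⟨a, K⟩ hp ⟨b, L⟩ hq h
    obtain ⟨ha, hK, -⟩ := hmemB _ hp
    obtain ⟨hb, hL, -⟩ := hmemB _ hq
    dsimp only at *
    have haK : a ∉ K := fun h => by have := hK a h; omega
    have hbL : b ∉ L := fun h => by have := hL b h; omega
    have hab : a = b := by
      have : a ∈ insert b L := h ▸ Finset.mem_insert_self a K
      rcases Finset.mem_insert.1 this with h | h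
      · exact h
      · have := hL a h
        omega
    subst hab
    rw [← Finset.erase_insert haK, h, Finset.erase_insert hbL]
  have hdisj : Disjoint A (B.image fun p => insert p.1 p.2) := by
    rw [Finset.disjoint_left]
    intro K hK hK'
    obtain ⟨p, hp, rfl⟩ := Finset.mem_image.1 hK'
    have := (hmemA _ hK).1 p.1 (Finset.mem_insert_self _ _)
    have := (hmemB p hp).1
    omega
  calc _ = #(A ∪ B.image fun p => insert p.1 p.2) := by
        rw [Finset.card_union_of_disjoint hdisj, Finset.card_image_of_injOn hinj, hA, hB,
          Finset.card_product, Finset.card_powersetCard, Finset.card_powersetCard,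
          card_filter_le_val hkn, card_filter_val_lt_of_le hkn]
    _ ≤ _ := Finset.card_le_card fun K hK => by
        simp only [Finset.mem_filter, Finset.mem_univ, true_and]
        rcases Finset.mem_union.1 hK with hK | hK
        · obtain ⟨h1, h2⟩ := hmemA K hK
          exact ⟨fun a ha b _ hab => hG a b (h1 a ha) hab, h2⟩
        · obtain ⟨p, hp, rfl⟩ := Finset.mem_image.1 hK
          obtain ⟨h1, h2, h3⟩ := hmemB p hp
          refine ⟨fun a ha b hb hab => ?_, ?_⟩
          · rcases Finset.mem_insert.1 ha with rfl | ha
            · rcases Finset.mem_insert.1 hb with rfl | hb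
              · exact absurd rfl hab
              · exact (hG b _ (h2 b hb) hab.symm).symm
            · exact hG a b (h2 a ha) hab
          · rw [Finset.card_insert_of_notMem (fun h => absurd (h2 _ h) (by omega)), h3]
            omega

/-- For `s ≥ 2` and `n ≥ 2k+1`, the maximum number of copies of `K_s` in an `n`-vertex
graph with no matching of `k+1` edges is `max{C(2k+1,s), C(k,s) + (n-k)·C(k,s-1)}`. -/
theorem stmt0 (n k s : ℕ) (hs : 2 ≤ s) (hn : 2 * k + 1 ≤ n) :
    IsGreatest {c | ∃ G : SimpleGraph (Fin n), ¬ containsMatching G (k + 1) ∧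
        c = cliqueCount G s}
      (max (Nat.choose (2 * k + 1) s) (Nat.choose k s + (n - k) * Nat.choose k (s - 1))) := by
  refine ⟨?_, ?_⟩
  · have hex : ∃ G : SimpleGraph (Fin n), ¬ containsMatching G (k + 1) ∧
        max ((2 * k + 1).choose s) (k.choose s + (n - k) * k.choose (s - 1)) ≤
          cliqueCount G s := by
      rcases le_total (k.choose s + (n - k) * k.choose (s - 1)) ((2 * k + 1).choose s) with h | h
      · rw [max_eq_left h]
        refine ⟨SimpleGraph.fromRel fun a b => (a : ℕ) < 2 * k + 1 ∧ (b : ℕ) < 2 * k + 1,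
          not_containsMatching_of_adj_lt hn ?_, choose_le_cliqueCount hn ?_⟩
        · intro a b hab
          rw [SimpleGraph.fromRel_adj] at hab
          tauto
        · intro a b ha hb hab
          rw [SimpleGraph.fromRel_adj]
          tauto
      · rw [max_eq_right h]
        refine ⟨SimpleGraph.fromRel fun a _ => (a : ℕ) < k,
          not_containsMatching_of_adj_lt_or (by omega) ?_,
          choose_add_le_cliqueCount (by omega) (by omega) ?_⟩
        · intro a b hab
          rw [SimpleGraph.fromRel_adj] at hab
          tauto
        · intro a b ha hab
          rw [SimpleGraph.fromRel_adj]
          tauto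
    obtain ⟨G, hG, hle⟩ := hex
    exact ⟨G, hG, hle.antisymm (cliqueCount_le_max hs hn hG)⟩
  · rintro c ⟨G, hG, rfl⟩
    exact cliqueCount_le_max hs hn hG
end

section
/- For odd k with k ≥ 3 and n ≥ (k−1)/2, and for any s = t ≥ 1, the maximum number of copies of K_{s,s} in a bipartite graph with both parts of size n that contains no linear forest with k edges equals C((k−1)/2, s)·C(n, s). -/
open SimpleGraph Finset

/-- A graph on `Fin n ⊕ Fin n` is bipartite with the two summands as parts. -/
def IsBip {n : ℕ} (G : SimpleGraph (Fin n ⊕ Fin n)) : Prop :=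
  ∀ a b : Fin n, ¬ G.Adj (Sum.inl a) (Sum.inl b) ∧ ¬ G.Adj (Sum.inr a) (Sum.inr b)

/-- Number of copies of `K_{s,t}` in a bipartite graph on parts `X = Fin n` (left) and
`Y = Fin n` (right): pairs `(S, T)` with `S ⊆ X`, `T ⊆ Y`, all `S`–`T` edges present, and
`(|S|, |T|) = (s, t)` or `(t, s)` (both orientations are counted). -/
noncomputable def bipKstCount {n : ℕ} (G : SimpleGraph (Fin n ⊕ Fin n)) (s t : ℕ) : ℕ :=
  {p : Finset (Fin n) × Finset (Fin n) |
    ((p.1.card = s ∧ p.2.card = t) ∨ (p.1.card = t ∧ p.2.card = s)) ∧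
    ∀ a ∈ p.1, ∀ b ∈ p.2, G.Adj (Sum.inl a) (Sum.inr b)}.ncard

namespace SimpleGraph

variable {V : Type*}

/-- In a graph of maximum degree at most two, a component has at most two vertices of
degree at most one. -/
theorem not_reachable_of_ncard_neighborSet_le_one [Finite V] {H : SimpleGraph V}
    (hdeg : ∀ v, (H.neighborSet v).ncard ≤ 2) {u v w : V} (huv : u ≠ v) (huw : u ≠ w)
    (hvw : v ≠ w) (hu : (H.neighborSet u).ncard ≤ 1) (hv : (H.neighborSet v).ncard ≤ 1)
    (hw : (H.neighborSet w).ncard ≤ 1) (h : H.Reachable u v) : ¬ H.Reachable u w := by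
  intro h'
  obtain ⟨p, hp⟩ := h.exists_isPath
  have hpos : 0 < p.length := by
    by_contra h0
    exact huv (Walk.eq_of_length_eq_zero (by omega : p.length = 0))
  have hclosed : ∀ z ∈ p.support, ∀ z', H.Adj z z' → z' ∈ p.support := by
    intro z hz z' hzz'
    obtain ⟨i, rfl, hi⟩ := Walk.mem_support_iff_exists_getVert.mp hz
    rcases Nat.eq_zero_or_pos i with rfl | hi0
    · have h1 : H.Adj (p.getVert 0) (p.getVert (0 + 1)) := p.adj_getVert_succ hpos
      rw [Walk.getVert_zero] at h1 hzz'
      rw [(Set.ncard_le_one (Set.toFinite _)).mp hu z' hzz' _ h1]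
      exact p.getVert_mem_support _
    rcases hi.eq_or_lt with rfl | hi
    · have h1 := p.adj_getVert_succ (i := p.length - 1) (by omega)
      rw [Nat.sub_add_cancel hpos] at h1
      rw [Walk.getVert_length] at h1 hzz'
      rw [(Set.ncard_le_one (Set.toFinite _)).mp hv z' hzz' _ h1.symm]
      exact p.getVert_mem_support _
    · have h1 := hp.ncard_neighborSet_toSubgraph_internal_eq_two hi0.ne' hi
      have h2 := Set.eq_of_subset_of_ncard_le (p.toSubgraph.neighborSet_subset (p.getVert i))
        (by rw [h1]; exact hdeg _) (Set.toFinite _)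
      have h3 : z' ∈ p.toSubgraph.neighborSet (p.getVert i) := by rw [h2]; exact hzz'
      rw [hp.neighborSet_toSubgraph_internal hi0.ne' hi] at h3
      rcases h3 with rfl | rfl <;> exact p.getVert_mem_support _
  have hmem : ∀ {a b : V}, H.Walk a b → a ∈ p.support → b ∈ p.support := by
    intro a b q
    induction q with
    | nil => exact id
    | cons hadj _ ih => exact fun ha => ih (hclosed _ ha _ hadj)
  obtain ⟨q⟩ := h'
  exact hp.isTrail.not_mem_support_of_subsingleton_neighborSet huw.symm hvw.symm
    (Set.ncard_le_one_iff_subsingleton.mp hw) (hmem q p.start_mem_support)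

/-- A set of vertices with total deficiency at least three contains two non-saturated vertices
in different components. -/
theorem exists_not_reachable_of_sum_lt [Finite V] {H : SimpleGraph V}
    (hdeg : ∀ v, (H.neighborSet v).ncard ≤ 2) (N : Finset V)
    (hN : ∑ x ∈ N, (H.neighborSet x).ncard + 3 ≤ 2 * #N) :
    ∃ u ∈ N, ∃ v ∈ N, (H.neighborSet u).ncard ≤ 1 ∧ (H.neighborSet v).ncard ≤ 1 ∧
      ¬ H.Reachable u v := by
  classical
  have hsum : 3 ≤ ∑ x ∈ N with (H.neighborSet x).ncard ≤ 1, (2 - (H.neighborSet x).ncard) := by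
    have h1 : ∑ x ∈ N, (2 - (H.neighborSet x).ncard) + ∑ x ∈ N, (H.neighborSet x).ncard
        = 2 * #N := by
      rw [← sum_add_distrib, sum_congr rfl (fun x _ => Nat.sub_add_cancel (hdeg x)), sum_const,
        smul_eq_mul, mul_comm]
    rw [sum_filter_of_ne (fun x _ hx => by omega)]
    omega
  set D := N.filter fun x => (H.neighborSet x).ncard ≤ 1 with hD
  have hDN : ∀ {x}, x ∈ D → x ∈ N ∧ (H.neighborSet x).ncard ≤ 1 := fun hx => by
    simpa [hD] using hx
  by_cases hzero : ∃ u ∈ D, (H.neighborSet u).ncard = 0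
  · obtain ⟨u, hu, hu0⟩ := hzero
    have hcard : 1 < #D := by
      have := sum_le_card_nsmul D (fun x => 2 - (H.neighborSet x).ncard) 2 (by simp)
      rw [smul_eq_mul] at this
      omega
    obtain ⟨v, hv, hvu⟩ := exists_mem_ne hcard u
    refine ⟨u, (hDN hu).1, v, (hDN hv).1, (hDN hu).2, (hDN hv).2, ?_⟩
    rintro ⟨q⟩
    rw [Set.ncard_eq_zero] at hu0
    cases q with
    | nil => exact hvu rfl
    | cons hadj _ => exact Set.notMem_empty _ (hu0 ▸ (H.mem_neighborSet _ _).mpr hadj)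
  · push Not at hzero
    have hcard : 2 < #D := by
      have := sum_le_card_nsmul D (fun x => 2 - (H.neighborSet x).ncard) 1 (fun x hx => by
        have := hzero x hx
        omega)
      rw [smul_eq_mul] at this
      omega
    obtain ⟨u, v, w, hu, hv, hw, huv, huw, hvw⟩ := two_lt_card_iff.mp hcard
    by_cases h : H.Reachable u v
    · exact ⟨u, (hDN hu).1, w, (hDN hw).1, (hDN hu).2, (hDN hw).2,
        not_reachable_of_ncard_neighborSet_le_one hdeg huv huw hvw (hDN hu).2 (hDN hv).2
          (hDN hw).2 h⟩
    · exact ⟨u, (hDN hu).1, v, (hDN hv).1, (hDN hu).2, (hDN hv).2, h⟩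

theorem neighborSet_sup_edge_subset (H : SimpleGraph V) (u v : V) :
    (H ⊔ edge u v).neighborSet u ⊆ insert v (H.neighborSet u) := by
  intro x hx
  simp only [mem_neighborSet, sup_adj, edge_adj] at hx
  grind [mem_neighborSet]

theorem neighborSet_sup_edge_of_ne (H : SimpleGraph V) {u v w : V} (hu : w ≠ u) (hv : w ≠ v) :
    (H ⊔ edge u v).neighborSet w = H.neighborSet w := by
  ext x
  simp only [mem_neighborSet, sup_adj, edge_adj]
  grind

theorem ncard_neighborSet_sup_edge_le [Finite V] (H : SimpleGraph V) (u v : V) :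
    ((H ⊔ edge u v).neighborSet u).ncard ≤ (H.neighborSet u).ncard + 1 :=
  (Set.ncard_le_ncard (H.neighborSet_sup_edge_subset u v) (Set.toFinite _)).trans
    (Set.ncard_insert_le _ _)

/-- Joining two non-saturated vertices in different components of a linear forest gives a
linear forest. -/
theorem isLinearForest_sup_edge [Finite V] {H : SimpleGraph V} {j : ℕ} (hac : H.IsAcyclic)
    (hdeg : ∀ v, (H.neighborSet v).ncard ≤ 2) (hcard : H.edgeSet.ncard = j) {u v : V}
    (hu : (H.neighborSet u).ncard ≤ 1) (hv : (H.neighborSet v).ncard ≤ 1)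
    (huv : ¬ H.Reachable u v) :
    (H ⊔ edge u v).IsAcyclic ∧ (∀ w, ((H ⊔ edge u v).neighborSet w).ncard ≤ 2) ∧
      (H ⊔ edge u v).edgeSet.ncard = j + 1 := by
  have hne : u ≠ v := fun h => huv (h ▸ .refl u)
  refine ⟨hac.sup_edge_of_not_reachable huv, fun w => ?_, ?_⟩
  · by_cases hwu : w = u
    · subst hwu
      exact (H.ncard_neighborSet_sup_edge_le w v).trans (by omega)
    by_cases hwv : w = v
    · subst hwv
      rw [edge_comm]
      exact (H.ncard_neighborSet_sup_edge_le w u).trans (by omega)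
    rw [H.neighborSet_sup_edge_of_ne hwu hwv]
    exact hdeg w
  · rw [edgeSet_sup, edgeSet_edge_of_ne hne, Set.union_singleton, Set.ncard_insert_of_notMem _
      (Set.toFinite _), hcard]
    exact fun h => huv (Adj.reachable h)

/-- Adding an edge outside the component of `v` does not change what is reachable from `v`. -/
theorem Reachable.of_sup_edge {H : SimpleGraph V} {u y v z : V} (hu : ¬ H.Reachable v u)
    (hy : ¬ H.Reachable v y) (h : (H ⊔ edge u y).Reachable v z) : H.Reachable v z := by
  obtain ⟨q⟩ := h
  have : ∀ {a b : V}, (H ⊔ edge u y).Walk a b → H.Reachable v a → H.Reachable v b := by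
    intro a b q
    induction q with
    | nil => exact id
    | cons hadj _ ih =>
      intro ha
      rcases hadj with hadj | hadj
      · exact ih (ha.trans (Adj.reachable hadj))
      · rw [edge_adj] at hadj
        rcases hadj.1 with ⟨rfl, _⟩ | ⟨rfl, _⟩
        exacts [(hu ha).elim, (hy ha).elim]
  exact this q (.refl v)

end SimpleGraph

section Bipartite

variable {n : ℕ} {G : SimpleGraph (Fin n ⊕ Fin n)}

theorem IsBip.anti {H : SimpleGraph (Fin n ⊕ Fin n)} (hG : IsBip G) (h : H ≤ G) : IsBip H :=
  fun a b => ⟨fun hab => (hG a b).1 (h hab), fun hab => (hG a b).2 (h hab)⟩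

theorem IsBip.sum_ncard_neighborSet (hG : IsBip G) :
    ∑ a : Fin n, (G.neighborSet (Sum.inl a)).ncard = G.edgeSet.ncard := by
  classical
  have hbip : G.IsBipartiteWith
      ((univ.map Function.Embedding.inl : Finset (Fin n ⊕ Fin n)) : Set (Fin n ⊕ Fin n))
      ((univ.map Function.Embedding.inr : Finset (Fin n ⊕ Fin n)) : Set (Fin n ⊕ Fin n)) := by
    refine ⟨?_, ?_⟩
    · rw [Finset.disjoint_coe, Finset.disjoint_left]
      simp
    · rintro (a | a) (b | b) hab
      · exact ((hG a b).1 hab).elim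
      · simp
      · simp
      · exact ((hG a b).2 hab).elim
  have h := isBipartiteWith_sum_degrees_eq_card_edges hbip
  rw [sum_map] at h
  rw [← coe_edgeFinset, Set.ncard_coe_finset, ← h]
  refine sum_congr rfl fun a _ => ?_
  rw [Set.ncard_eq_toFinset_card', ← card_neighborFinset_eq_degree]
  rfl

/-- Deleting a right vertex of degree at least `m + 2` from a bipartite graph without linear
forests with `2 * m + 3` edges destroys all linear forests with `2 * m + 1` edges. -/
theorem not_containsLinearForest_deleteIncidenceSet {m : ℕ} (hG : IsBip G)
    (hfree : ¬ containsLinearForest G (2 * m + 3)) {y : Fin n} {N : Finset (Fin n)}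
    (hNadj : ∀ x ∈ N, G.Adj (Sum.inl x) (Sum.inr y)) (hN : m + 2 ≤ #N) :
    ¬ containsLinearForest (G.deleteIncidenceSet (Sum.inr y)) (2 * m + 1) := by
  rintro ⟨H, hHG, hac, hdeg, hcard⟩
  have hHG' : H ≤ G := hHG.trans (deleteIncidenceSet_le _ _)
  have hy : ∀ z, ¬ H.Adj (Sum.inr y) z := fun z hz =>
    (deleteIncidenceSet_adj.mp (hHG hz)).2.1 rfl
  have hy0 : H.neighborSet (Sum.inr y) = ∅ := Set.eq_empty_of_forall_notMem hy
  have hyr : ∀ x, ¬ H.Reachable (Sum.inl x) (Sum.inr y) := by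
    intro x hr
    obtain ⟨q⟩ := hr.symm
    cases q with
    | cons hadj _ => exact hy _ hadj
  obtain ⟨u, hu, v, hv, hu1, hv1, huv⟩ := exists_not_reachable_of_sum_lt hdeg
    (N.map Function.Embedding.inl) (by
      have h1 := (hG.anti hHG').sum_ncard_neighborSet
      have h2 : ∑ a ∈ N, (H.neighborSet (Sum.inl a)).ncard ≤
          ∑ a : Fin n, (H.neighborSet (Sum.inl a)).ncard := sum_le_univ_sum_of_nonneg (by simp)
      rw [sum_map, card_map]
      simp only [Function.Embedding.inl_apply]
      omega)
  obtain ⟨u, huN, rfl⟩ := mem_map.mp hu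
  obtain ⟨v, hvN, rfl⟩ := mem_map.mp hv
  simp only [Function.Embedding.inl_apply] at hu1 hv1 huv
  obtain ⟨hac', hdeg', hcard'⟩ := isLinearForest_sup_edge hac hdeg hcard hu1
    (by simp [hy0]) (hyr u)
  have hne : u ≠ v := fun h => huv (h ▸ .refl _)
  obtain ⟨hac'', hdeg'', hcard''⟩ := isLinearForest_sup_edge hac' hdeg' hcard'
    (u := Sum.inl v) (v := Sum.inr y)
    (by rwa [H.neighborSet_sup_edge_of_ne (by simpa using hne.symm) (by simp)])
    (by
      rw [edge_comm]
      exact (H.ncard_neighborSet_sup_edge_le _ _).trans (by simp [hy0]))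
    (fun h => hyr v (Reachable.of_sup_edge (fun h => huv h.symm) (hyr v) h))
  exact hfree ⟨_, sup_le (sup_le hHG' ((edge_le_iff _).mpr (.inr (hNadj u huN))))
    ((edge_le_iff _).mpr (.inr (hNadj v hvN))), hac'', hdeg'', hcard''⟩

theorem containsLinearForest_one_of_adj {V : Type*} [Finite V] {G : SimpleGraph V} {u v : V}
    (h : G.Adj u v) : containsLinearForest G 1 := by
  have hr : ¬ (⊥ : SimpleGraph V).Reachable u v := by
    rw [reachable_bot]
    exact h.ne
  exact ⟨_, sup_le bot_le ((edge_le_iff _).mpr (.inr h)), isLinearForest_sup_edge (H := ⊥) (j := 0)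
    (by simp) (by simp) (by simp) (by simp) (by simp) hr⟩

end Bipartite

section Counting

variable {α β : Type*} [Fintype α] [Fintype β]

open Classical in
/-- The complete bipartite pairs `(S, T)` of the relation `R` with `|S| = s` and `|T| = t`. -/
noncomputable def bicliques (R : α → β → Prop) (s t : ℕ) : Finset (Finset α × Finset β) :=
  (powersetCard s univ ×ˢ powersetCard t univ).filter fun p => ∀ a ∈ p.1, ∀ b ∈ p.2, R a b

theorem mem_bicliques {R : α → β → Prop} {s t : ℕ} {p : Finset α × Finset β} :
    p ∈ bicliques R s t ↔ (#p.1 = s ∧ #p.2 = t) ∧ ∀ a ∈ p.1, ∀ b ∈ p.2, R a b := by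
  simp [bicliques, mem_powersetCard]

theorem card_bicliques_le (R : α → β → Prop) (s t : ℕ) :
    #(bicliques R s t) ≤ (Fintype.card α).choose s * (Fintype.card β).choose t := by
  classical
  refine (card_filter_le _ _).trans ?_
  simp

open Classical in
theorem card_bicliques_le_of_degree_le {R : α → β → Prop} {s t m : ℕ} (ht : 1 ≤ t)
    (hR : ∀ b, #{a | R a b} ≤ m) :
    #(bicliques R s t) ≤ m.choose s * (Fintype.card β).choose t := by
  have h := card_le_mul_card_image_of_maps_to (s := bicliques R s t) (f := Prod.snd)
    (t := powersetCard t univ)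
    (fun p hp => mem_powersetCard.mpr ⟨subset_univ _, (mem_bicliques.mp hp).1.2⟩)
    (m.choose s) (fun T hT => ?_)
  · simpa using h
  obtain ⟨b, hb⟩ := card_pos.mp ((mem_powersetCard.mp hT).2.symm ▸ ht : 0 < #T)
  refine le_trans ?_ (Nat.choose_le_choose s (hR b))
  rw [← card_powersetCard]
  refine card_le_card_of_injOn Prod.fst (fun p hp => ?_) (fun p hp q hq h => ?_)
  · simp only [coe_filter, Set.mem_ofPred_eq, mem_bicliques] at hp
    simp only [mem_coe, mem_powersetCard]
    refine ⟨fun a ha => ?_, hp.1.1.1⟩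
    simpa using hp.1.2 a ha b (hp.2 ▸ hb)
  · simp only [coe_filter, Set.mem_ofPred_eq] at hp hq
    exact Prod.ext h (hp.2.trans hq.2.symm)

/-- Splitting bicliques according to whether they contain the right vertex `y`. -/
theorem card_bicliques_succ_le (R : α → β → Prop) (s t : ℕ) (y : β) :
    #(bicliques R s (t + 1)) ≤ #(bicliques (fun a b => R a b ∧ b ≠ y) s (t + 1)) +
      #(bicliques (fun a b => R a b ∧ b ≠ y) s t) := by
  classical
  rw [← card_filter_add_card_filter_not (s := bicliques R s (t + 1)) (fun p => y ∉ p.2)]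
  refine add_le_add (card_le_card fun p hp => ?_) ?_
  · simp only [mem_filter, mem_bicliques] at hp ⊢
    exact ⟨hp.1.1, fun a ha b hb => ⟨hp.1.2 a ha b hb, fun h => hp.2 (h ▸ hb)⟩⟩
  · refine card_le_card_of_injOn (fun p => (p.1, p.2.erase y)) (fun p hp => ?_)
      (fun p hp q hq h => ?_)
    · simp only [coe_filter, Set.mem_ofPred_eq, mem_bicliques, not_not] at hp
      simp only [mem_coe, mem_bicliques, mem_erase]
      exact ⟨⟨hp.1.1.1, by rw [card_erase_of_mem hp.2, hp.1.1.2]; rfl⟩,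
        fun a ha b hb => ⟨hp.1.2 a ha b hb.2, hb.1⟩⟩
    · simp only [coe_filter, Set.mem_ofPred_eq, not_not] at hp hq
      rw [Prod.mk.injEq] at h
      exact Prod.ext h.1 (by rw [← insert_erase hp.2, h.2, insert_erase hq.2])

end Counting

theorem Nat.choose_mul_choose_le_of_le {m n s t : ℕ} (hmn : m ≤ n) (hts : t ≤ s) :
    m.choose s * n.choose t ≤ m.choose t * n.choose s := by
  refine Nat.le_of_mul_le_mul_right ?_ (Nat.choose_pos hts)
  calc m.choose s * n.choose t * s.choose t
      = m.choose s * s.choose t * n.choose t := by ring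
    _ = m.choose t * (m - t).choose (s - t) * n.choose t := by rw [Nat.choose_mul hts]
    _ ≤ m.choose t * (n - t).choose (s - t) * n.choose t := by gcongr
    _ = m.choose t * (n.choose t * (n - t).choose (s - t)) := by ring
    _ = m.choose t * n.choose s * s.choose t := by rw [← Nat.choose_mul hts]; ring

/-- A bipartite graph with parts of size `n` and no linear forest with `2 * m + 1` edges has at
most `C(m, t) * C(n, s)` copies of `K_{s,t}` with a fixed orientation, where `t ≤ s`. -/
theorem card_bicliques_le_of_not_containsLinearForest {n s t : ℕ} (hts : t ≤ s) (m : ℕ)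
    {G : SimpleGraph (Fin n ⊕ Fin n)} (hG : IsBip G)
    (hfree : ¬ containsLinearForest G (2 * m + 1)) :
    #(bicliques (fun a b => G.Adj (Sum.inl a) (Sum.inr b)) s t) ≤ m.choose t * n.choose s := by
  classical
  induction m generalizing t G with
  | zero =>
    obtain rfl | ht := Nat.eq_zero_or_pos t
    · simpa using card_bicliques_le (fun a b => G.Adj (Sum.inl a) (Sum.inr b)) s 0
    · have h := card_bicliques_le_of_degree_le (s := s) (m := 0) ht
        (R := fun a b => G.Adj (Sum.inl a) (Sum.inr b)) (fun b => by
          rw [Nat.le_zero, card_eq_zero, filter_eq_empty_iff]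
          exact fun a _ h => hfree (containsLinearForest_one_of_adj h))
      simpa using h.trans (by simpa using Nat.choose_mul_choose_le_of_le (Nat.zero_le n) hts)
  | succ m ih =>
    obtain rfl | ht := Nat.eq_zero_or_pos t
    · simpa using card_bicliques_le (fun a b => G.Adj (Sum.inl a) (Sum.inr b)) s 0
    rcases le_total n (m + 1) with hnm | hmn
    · refine (card_bicliques_le _ s t).trans ?_
      rw [Fintype.card_fin, mul_comm]
      exact Nat.mul_le_mul_right _ (Nat.choose_le_choose t hnm)
    by_cases hdeg : ∀ b, #{a : Fin n | G.Adj (Sum.inl a) (Sum.inr b)} ≤ m + 1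
    · refine (card_bicliques_le_of_degree_le ht hdeg).trans ?_
      rw [Fintype.card_fin]
      exact Nat.choose_mul_choose_le_of_le hmn hts
    push Not at hdeg
    obtain ⟨y, hy⟩ := hdeg
    obtain ⟨t, rfl⟩ : ∃ t', t = t' + 1 := ⟨t - 1, by omega⟩
    have hdel := not_containsLinearForest_deleteIncidenceSet hG hfree (y := y)
      (fun x hx => (mem_filter.mp hx).2) hy
    have hbip := hG.anti (deleteIncidenceSet_le G (Sum.inr y))
    have hrel : (fun a b => (G.deleteIncidenceSet (Sum.inr y)).Adj (Sum.inl a) (Sum.inr b)) =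
        fun a b => G.Adj (Sum.inl a) (Sum.inr b) ∧ b ≠ y := by
      ext a b
      simp [deleteIncidenceSet_adj]
    have h1 := ih hts hbip hdel
    have h2 := ih (t := t) (by omega) hbip hdel
    rw [hrel] at h1 h2
    refine (card_bicliques_succ_le _ s t y).trans ((add_le_add h1 h2).trans_eq ?_)
    rw [Nat.choose_succ_succ]
    ring

theorem bipKstCount_self_eq_card_bicliques {n : ℕ} (G : SimpleGraph (Fin n ⊕ Fin n)) (s : ℕ) :
    bipKstCount G s s = #(bicliques (fun a b => G.Adj (Sum.inl a) (Sum.inr b)) s s) := by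
  rw [bipKstCount, ← Set.ncard_coe_finset]
  congr 1
  ext p
  simp [mem_bicliques]

/-- The complete bipartite graph between the first `m` left vertices and all right vertices. -/
def leftStar (n m : ℕ) : SimpleGraph (Fin n ⊕ Fin n) :=
  SimpleGraph.fromRel fun x y => ∃ a b, x = Sum.inl a ∧ y = Sum.inr b ∧ a.val < m

theorem leftStar_adj_inl {n m : ℕ} {a : Fin n} {z : Fin n ⊕ Fin n} :
    (leftStar n m).Adj (Sum.inl a) z ↔ a.val < m ∧ ∃ b, z = Sum.inr b := by
  simp only [leftStar, fromRel_adj]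
  aesop

theorem isBip_leftStar (n m : ℕ) : IsBip (leftStar n m) := by
  intro a b
  simp [leftStar]

theorem not_containsLinearForest_leftStar (n m : ℕ) :
    ¬ containsLinearForest (leftStar n m) (2 * m + 1) := by
  rintro ⟨H, hH, -, hdeg, hcard⟩
  have h1 := ((isBip_leftStar n m).anti hH).sum_ncard_neighborSet
  have h2 : ∑ a : Fin n, (H.neighborSet (Sum.inl a)).ncard ≤
      ∑ a : Fin n, if a.val < m then 2 else 0 := by
    refine sum_le_sum fun a _ => ?_
    split_ifs with ha
    · exact hdeg _
    · rw [Nat.le_zero, Set.ncard_eq_zero]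
      exact Set.eq_empty_of_forall_notMem fun z hz => ha (leftStar_adj_inl.mp (hH hz)).1
  rw [← sum_filter, sum_const, smul_eq_mul, Fin.card_filter_val_lt] at h2
  have := min_le_right n m
  omega

theorem card_bicliques_leftStar {n m s : ℕ} (hmn : m ≤ n) (hs : 1 ≤ s) :
    #(bicliques (fun a b => (leftStar n m).Adj (Sum.inl a) (Sum.inr b)) s s) =
      m.choose s * n.choose s := by
  classical
  have : bicliques (fun a b => (leftStar n m).Adj (Sum.inl a) (Sum.inr b)) s s =
      powersetCard s (univ.filter fun a : Fin n => a.val < m) ×ˢ powersetCard s univ := by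
    ext ⟨S, T⟩
    simp only [mem_bicliques, leftStar_adj_inl, mem_product, mem_powersetCard, subset_univ]
    constructor
    · rintro ⟨⟨hS, hT⟩, h⟩
      obtain ⟨b, hb⟩ := card_pos.mp (hT.symm ▸ hs : 0 < #T)
      exact ⟨⟨fun a ha => by simpa using (h a ha b hb).1, hS⟩, trivial, hT⟩
    · rintro ⟨⟨hS, hS'⟩, -, hT⟩
      exact ⟨⟨hS', hT⟩, fun a ha b _ => ⟨by simpa using hS ha, b, rfl⟩⟩
  rw [this, card_product, card_powersetCard, card_powersetCard, Fin.card_filter_val_lt, card_fin,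
    min_eq_right hmn]

/-- For odd `k ≥ 3`, `n ≥ (k-1)/2` and `s ≥ 1`, the maximum number of copies of `K_{s,s}`
in a bipartite graph with parts of size `n` and no linear forest with `k` edges is
`C((k-1)/2, s)·C(n, s)`. -/
theorem stmt12 (n k s : ℕ) (hk : Odd k) (hk3 : 3 ≤ k) (hn : (k - 1) / 2 ≤ n) (hs : 1 ≤ s) :
    IsGreatest {c | ∃ G : SimpleGraph (Fin n ⊕ Fin n), IsBip G ∧
        ¬ containsLinearForest G k ∧ c = bipKstCount G s s}
      (Nat.choose ((k - 1) / 2) s * Nat.choose n s) := by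
  obtain ⟨m, rfl⟩ := hk
  have hm : (2 * m + 1 - 1) / 2 = m := by omega
  rw [hm] at hn ⊢
  refine ⟨⟨leftStar n m, isBip_leftStar n m, not_containsLinearForest_leftStar n m, ?_⟩, ?_⟩
  · rw [bipKstCount_self_eq_card_bicliques, card_bicliques_leftStar hn hs]
  · rintro c ⟨G, hG, hfree, rfl⟩
    rw [bipKstCount_self_eq_card_bicliques]
    exact card_bicliques_le_of_not_containsLinearForest le_rfl m hG hfree
end
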